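/- Let T be a regular interval exchange transformation on alphabet A with associated factor set F = F(T), and let w ∈ F. Then the set R_F(w) of first right return words to w is a basis of the free group on A; in particular it has exactly Card(A) elements. -/

import Mathlib

open Set

/-- An interval exchange transformation on `[l, r)` exchanging `s` half-open
intervals with boundaries `γ 0 = l < γ 1 < … < γ s = r`, translation values `α`,
and permutation `π` (ordering of the image intervals). -/
structure IET (s : ℕ) where
  l : ℝ
  r : ℝ
  hlr : l < r
  γ : Fin (s + 1) → ℝ
  γ_mono : StrictMono γ
  γ_first : γ 0 = l
  γ_last : γ (Fin.last s) = r
  α : Fin s → ℝ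
  π : Equiv.Perm (Fin s)
  T : ℝ → ℝ
  Tinv : ℝ → ℝ
  hT : ∀ i : Fin s, ∀ x ∈ Ico (γ i.castSucc) (γ i.succ), T x = x + α i
  hmaps : MapsTo T (Ico l r) (Ico l r)
  hinv_left : ∀ x ∈ Ico l r, Tinv (T x) = x
  hinv_right : ∀ x ∈ Ico l r, T (Tinv x) = x
  hinvmaps : MapsTo Tinv (Ico l r) (Ico l r)
  himg_mono : StrictMono fun k : Fin s => γ (Fin.castSucc (π.symm k)) + α (π.symm k)

namespace IET

variable {s : ℕ} (X : IET s)

/-- The `i`-th exchanged interval `I_i`. -/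
def I (i : Fin s) : Set ℝ := Ico (X.γ i.castSucc) (X.γ i.succ)

/-- The separation points `γ_1, …, γ_s` (left boundaries of the `I_i`). -/
def sep (i : Fin s) : ℝ := X.γ i.castSucc

/-- `δ i` : left boundary of the image interval `J_i = T(I_i)`. -/
def δ (i : Fin s) : ℝ := X.γ i.castSucc + X.α i

/-- `ℤ`-iterate of the transformation. -/
def iter (n : ℤ) : ℝ → ℝ := if 0 ≤ n then (X.T)^[n.toNat] else (X.Tinv)^[(-n).toNat]

/-- The two-sided orbit of a point. -/
def orbit (z : ℝ) : Set ℝ := {y | ∃ n : ℤ, X.iter n z = y}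

/-- Minimality: every orbit is dense in `[l, r)`. -/
def Minimal : Prop :=
  ∀ z ∈ Ico X.l X.r, ∀ y ∈ Ico X.l X.r, ∀ ε : ℝ, 0 < ε → ∃ w ∈ X.orbit z, |w - y| < ε

/-- Regularity (Keane's idoc condition): the orbits of the nonzero separation
points are infinite and pairwise disjoint. -/
def Regular : Prop :=
  ∀ i j : Fin s, (i : ℕ) ≠ 0 → (j : ℕ) ≠ 0 → ∀ m n : ℤ,
    X.iter m (X.sep i) = X.iter n (X.sep j) → i = j ∧ m = n

/-- `I_w` : the set of points whose natural coding begins with the word `w`. -/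
def Iw (X : IET s) : List (Fin s) → Set ℝ
  | [] => Ico X.l X.r
  | b :: w => X.I b ∩ X.T ⁻¹' (Iw X w)

/-- `J_w = T^{|w|}(I_w)`. -/
def Jw (w : List (Fin s)) : Set ℝ := (X.T)^[w.length] '' X.Iw w

/-- The factor set `F(T)` of the natural codings of `T`. -/
def Fact : Set (List (Fin s)) := {w | (X.Iw w).Nonempty}

/-- First (positive) return time of `z` to the set `J`. -/
noncomputable def retTime (J : Set ℝ) (z : ℝ) : ℕ := sInf {n : ℕ | 0 < n ∧ (X.T)^[n] z ∈ J}

/-- First return map of `T` on the set `J`. -/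
noncomputable def firstReturn (J : Set ℝ) (z : ℝ) : ℝ := (X.T)^[X.retTime J z] z

/-- `ρ⁺_{[u,v),T}(z) = min {n > 0 | T^n z ∈ (u,v)}`. -/
noncomputable def rhoP (u v z : ℝ) : ℕ := sInf {n : ℕ | 0 < n ∧ X.iter n z ∈ Ioo u v}

/-- `ρ⁻_{[u,v),T}(z) = min {n ≥ 0 | T^{-n} z ∈ (u,v)}`. -/
noncomputable def rhoM (u v z : ℝ) : ℕ := sInf {n : ℕ | X.iter (-(n : ℤ)) z ∈ Ioo u v}

/-- The set of neighbors of `z` with respect to `[u,v)` and `T`. -/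
def nbrs (u v z : ℝ) : Set ℝ :=
  {y | ∃ k : ℤ, -(X.rhoM u v z : ℤ) ≤ k ∧ k < (X.rhoP u v z : ℤ) ∧ X.iter k z = y}

/-- The set of division points of `[u,v)` with respect to `T`. -/
def Div (u v : ℝ) : Set ℝ := ⋃ i : Fin s, X.nbrs u v (X.sep i)

/-- A semi-interval `[u,v) ⊆ [l,r)` is admissible for `T` if both of its
endpoints belong to `Div([u,v),T) ∪ {r}`. -/
def Admissible (u v : ℝ) : Prop :=
  X.l ≤ u ∧ u < v ∧ v ≤ X.r ∧ u ∈ X.Div u v ∧ (v ∈ X.Div u v ∨ v = X.r)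

/-- `Y` is (a presentation of) the transformation induced by `X` on `[u,v)`:
its domain is `[u,v)`, it acts as the first return map of `X`, and its
separation points are the division points of `[u,v)` inside `[u,v)`. -/
def InducedOn (Y : IET s) (u v : ℝ) : Prop :=
  Y.l = u ∧ Y.r = v ∧ (∀ z ∈ Ico u v, Y.T z = X.firstReturn (Ico u v) z) ∧
    {y | ∃ i : Fin s, Y.sep i = y} = X.Div u v ∩ Ico u v

end IET

namespace IET

variable {s : ℕ}

/-- The set `Γ_F(w)` of right return words to `w` in `F`. -/
def Gamma (F : Set (List (Fin s))) (w : List (Fin s)) : Set (List (Fin s)) :=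
  {x | x ∈ F ∧ w ++ x ∈ F ∧ ∃ y : List (Fin s), y ≠ [] ∧ w ++ x = y ++ w}

/-- The set `R_F(w) = Γ_F(w) \ Γ_F(w)A⁺` of first right return words to `w`. -/
def RetW (F : Set (List (Fin s))) (w : List (Fin s)) : Set (List (Fin s)) :=
  {x | x ∈ Gamma F w ∧ ∀ p ∈ Gamma F w, ∀ t : List (Fin s), t ≠ [] → x ≠ p ++ t}

end IET


/-- Free groups are residually finite (concrete form). -/
theorem freeGroup_exists_perm {α : Type} (g : FreeGroup α) (hg : g ≠ 1) :
    ∃ (S : Type) (_ : Finite S) (ρ : FreeGroup α →* Equiv.Perm S), ρ g ≠ 1 := by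
  classical
  obtain ⟨L, rfl⟩ : ∃ L, FreeGroup.mk L = g := ⟨g.toWord, FreeGroup.mk_toWord⟩
  let S : Type := {h : FreeGroup α // h ∈ (L.tails.map FreeGroup.mk).toFinset}
  have hS : ∀ L', L' <:+ L → FreeGroup.mk L' ∈ (L.tails.map FreeGroup.mk).toFinset := by
    intro L' h
    simp only [List.mem_toFinset, List.mem_map, List.mem_tails]
    exact ⟨L', h, rfl⟩
  have key : ∀ a : α, ∃ σ : Equiv.Perm S, ∀ x y : S, y.1 = FreeGroup.of a * x.1 → σ x = y := by
    intro a
    let e : {x : S // ∃ y : S, y.1 = FreeGroup.of a * x.1} ≃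
        {y : S // ∃ x : S, y.1 = FreeGroup.of a * x.1} :=
      { toFun := fun x => ⟨x.2.choose, x.1, x.2.choose_spec⟩
        invFun := fun y => ⟨y.2.choose, y.1, y.2.choose_spec⟩
        left_inv := by
          intro x
          apply Subtype.ext
          apply Subtype.ext
          have h1 := x.2.choose_spec
          have h2 := (⟨x.1, x.2.choose_spec⟩ :
            ∃ x' : S, x.2.choose.1 = FreeGroup.of a * x'.1).choose_spec
          have := h2.symm.trans h1
          exact mul_left_cancel this
        right_inv := by
          intro y
          apply Subtype.ext
          apply Subtype.ext
          have h1 := y.2.choose_spec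
          have h2 := (⟨y.1, y.2.choose_spec⟩ :
            ∃ y' : S, y'.1 = FreeGroup.of a * y.2.choose.1).choose_spec
          exact h2.trans h1.symm }
    refine ⟨e.extendSubtype, fun x y h => ?_⟩
    rw [e.extendSubtype_apply_of_mem x ⟨y, h⟩]
    apply Subtype.ext
    have h1 := (⟨y, h⟩ : ∃ y : S, y.1 = FreeGroup.of a * x.1).choose_spec
    exact h1.trans h.symm
  choose σ hσ using key
  refine ⟨S, inferInstance, FreeGroup.lift σ, ?_⟩
  have main : ∀ L' (h : L' <:+ L), (FreeGroup.lift σ (FreeGroup.mk L'))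
      (⟨FreeGroup.mk [], hS [] List.nil_suffix⟩ : S) = ⟨FreeGroup.mk L', hS L' h⟩ := by
    intro L'
    induction L' with
    | nil => 
      intro h
      have h1 : FreeGroup.lift σ (FreeGroup.mk []) = 1 := map_one _
      rw [h1]; rfl
    | cons p L'' ih =>
      intro h
      have h' : L'' <:+ L := (List.suffix_cons p L'').trans h
      have hc : FreeGroup.mk (p :: L'') = FreeGroup.mk [p] * FreeGroup.mk L'' := by
        rw [FreeGroup.mul_mk]; rfl
      obtain ⟨a, b⟩ := p
      have hl : FreeGroup.lift σ (FreeGroup.mk ((a, b) :: L'')) =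
        FreeGroup.lift σ (FreeGroup.mk [(a, b)]) * FreeGroup.lift σ (FreeGroup.mk L'') := by
        rw [hc, map_mul]
      rw [hl, Equiv.Perm.mul_apply, ih h']
      cases b with
      | true =>
        have : FreeGroup.lift σ (FreeGroup.mk [(a, true)]) = σ a := FreeGroup.lift_apply_of
        rw [this]
        exact hσ a _ _ hc
      | false =>
        have h0 : (FreeGroup.mk [(a, false)] : FreeGroup α) = (FreeGroup.of a)⁻¹ := by
          simp [FreeGroup.of, FreeGroup.inv_mk, FreeGroup.invRev]
        have : FreeGroup.lift σ (FreeGroup.mk [(a, false)]) = (σ a)⁻¹ := by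
          rw [h0, map_inv, FreeGroup.lift_apply_of]
        rw [this, Equiv.Perm.inv_eq_iff_eq]
        refine (hσ a _ _ ?_).symm
        simp only
        rw [hc, h0, mul_inv_cancel_left]
  intro h1
  have := main L (List.suffix_refl L)
  rw [h1] at this
  apply hg
  have := congrArg Subtype.val this
  simpa [FreeGroup.one_eq_mk] using this.symm

/-- Free groups of finite rank are Hopfian. -/
theorem freeGroup_hopfian {α : Type} [Finite α] (f : FreeGroup α →* FreeGroup α)
    (hf : Function.Surjective f) : Function.Injective f := by
  rw [injective_iff_map_eq_one]
  intro g hg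
  by_contra hne
  obtain ⟨S, hS, ρ, hρ⟩ := freeGroup_exists_perm g hne
  have : Finite (FreeGroup α →* Equiv.Perm S) :=
    Finite.of_equiv (α → Equiv.Perm S) FreeGroup.lift
  have hinj : Function.Injective (fun q : FreeGroup α →* Equiv.Perm S => q.comp f) := by
    intro q q' h
    exact (MonoidHom.cancel_right hf).1 h
  obtain ⟨q, hq⟩ := (Finite.injective_iff_surjective.1 hinj) ρ
  apply hρ
  rw [← hq]
  simp [hg]

/-- A generating set with at most `s` elements of the free group of rank `s` is a basis. -/
theorem basis_of_generating {s : ℕ} [NeZero s] (R : Set (List (Fin s))) (hfin : R.Finite)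
    (hcard : R.ncard ≤ s)
    (hgen : Subgroup.closure ((fun x : List (Fin s) => (x.map FreeGroup.of).prod) '' R) = ⊤) :
    (∃ θ : FreeGroup (Fin s) ≃* FreeGroup (Fin s),
      (fun x : List (Fin s) => (x.map FreeGroup.of).prod) '' R =
        Set.range fun a : Fin s => θ (FreeGroup.of a)) ∧ R.ncard = s := by
  classical
  set wd := (fun x : List (Fin s) => (x.map FreeGroup.of).prod) with hwd
  have hne : R.Nonempty := by
    by_contra h
    rw [Set.not_nonempty_iff_eq_empty] at h
    rw [h, image_empty, Subgroup.closure_empty] at hgen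
    have : FreeGroup.of (0 : Fin s) ∈ (⊥ : Subgroup (FreeGroup (Fin s))) := hgen ▸ Subgroup.mem_top _
    exact FreeGroup.of_ne_one _ (Subgroup.mem_bot.1 this)
  obtain ⟨e, he⟩ : ∃ e : Fin s → List (Fin s), Set.range e = R := by
    have : Nonempty R := hne.to_subtype
    have : Fintype R := hfin.fintype
    have hc : Fintype.card R ≤ Fintype.card (Fin s) := by
      rw [← Nat.card_eq_fintype_card, Nat.card_coe_set_eq, Fintype.card_fin]; exact hcard
    obtain ⟨g⟩ := Function.Embedding.nonempty_of_card_le hc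
    refine ⟨fun a => (Function.invFun g a).1, ?_⟩
    rw [show (fun a => (Function.invFun g a).1) = Subtype.val ∘ Function.invFun g from rfl,
      (Function.invFun_surjective g.injective).range_comp, Subtype.range_val]
  let f : FreeGroup (Fin s) →* FreeGroup (Fin s) := FreeGroup.lift fun a => wd (e a)
  have himg : wd '' R = Set.range fun a => wd (e a) := by
    rw [← he, ← Set.range_comp]; rfl
  have hsurj : Function.Surjective f := by
    rw [← MonoidHom.range_eq_top, ← top_le_iff, ← hgen, Subgroup.closure_le, himg]
    rintro _ ⟨a, rfl⟩
    exact ⟨FreeGroup.of a, FreeGroup.lift_apply_of⟩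
  have hinj := freeGroup_hopfian f hsurj
  refine ⟨⟨MulEquiv.ofBijective f ⟨hinj, hsurj⟩, ?_⟩, ?_⟩
  · rw [himg]
    congr 1
    funext a
    exact (FreeGroup.lift_apply_of (f := fun a => wd (e a))).symm
  · refine le_antisymm hcard ?_
    have hei : Function.Injective e := by
      intro a b h
      apply FreeGroup.of_injective
      apply hinj
      simp [f, h]
    have : (Set.range e).ncard = s := by
      rw [← Set.image_univ, Set.ncard_image_of_injective _ hei, Set.ncard_univ]; simp
    rw [← he, this]

namespace IET

variable {s : ℕ} (X : IET s)

theorem s_ne_zero (X : IET s) : s ≠ 0 := by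
  rintro rfl
  have h := X.hlr
  rw [← X.γ_first, ← X.γ_last] at h
  exact lt_irrefl _ h

theorem exists_I {z : ℝ} (hz : z ∈ Ico X.l X.r) : ∃ i, z ∈ X.I i := by
  have key : ∀ k : Fin (s + 1), z < X.γ k → ∃ i, z ∈ X.I i := by
    intro k
    induction k using Fin.induction with
    | zero => intro h; rw [X.γ_first] at h; exact absurd hz.1 (not_le.2 h)
    | succ i ih =>
      intro h
      by_cases h' : z < X.γ i.castSucc
      · exact ih h'
      · exact ⟨i, not_lt.1 h', h⟩
  exact key (Fin.last s) (by rw [X.γ_last]; exact hz.2)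

theorem I_sub {i : Fin s} {z : ℝ} (hz : z ∈ X.I i) : z ∈ Ico X.l X.r := by
  constructor
  · rw [← X.γ_first]; exact (X.γ_mono.monotone (Fin.zero_le _)).trans hz.1
  · rw [← X.γ_last]; exact hz.2.trans_le (X.γ_mono.monotone (Fin.le_last _))

theorem I_unique {i j : Fin s} {z : ℝ} (hi : z ∈ X.I i) (hj : z ∈ X.I j) : i = j := by
  have key : ∀ i j : Fin s, z ∈ X.I i → z ∈ X.I j → ¬ i < j := by
    intro i j hi hj h
    have : X.γ i.succ ≤ X.γ j.castSucc := X.γ_mono.monotone (by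
      rw [Fin.le_def]; simp; exact h)
    exact absurd (hi.2.trans_le this) (not_lt.2 hj.1)
  rcases lt_trichotomy i j with h | h | h
  · exact absurd h (key i j hi hj)
  · exact h
  · exact absurd h (key j i hj hi)

theorem sep_mem_I (i : Fin s) : X.sep i ∈ X.I i :=
  ⟨le_refl _, X.γ_mono Fin.castSucc_lt_succ⟩

theorem sep_zero {i : Fin s} (hi : (i : ℕ) = 0) : X.sep i = X.l := by
  rw [← X.γ_first]; unfold sep; congr 1; ext; simpa using hi

/-- index of the interval containing `z` -/
noncomputable def idx (X : IET s) (z : ℝ) : Fin s :=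
  @Classical.epsilon _ ⟨⟨0, Nat.pos_of_ne_zero X.s_ne_zero⟩⟩ fun i => z ∈ X.I i

theorem idx_mem {z : ℝ} (hz : z ∈ Ico X.l X.r) : z ∈ X.I (X.idx z) :=
  Classical.epsilon_spec_aux _ _ (X.exists_I hz)

theorem idx_eq {z : ℝ} {i : Fin s} (hz : z ∈ X.I i) : X.idx z = i :=
  X.I_unique (X.idx_mem (X.I_sub hz)) hz

theorem T_eq {z : ℝ} {i : Fin s} (hz : z ∈ X.I i) : X.T z = z + X.α i := X.hT i z hz

theorem T_mem {z : ℝ} (hz : z ∈ Ico X.l X.r) : X.T z ∈ Ico X.l X.r := X.hmaps hz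

theorem iter_mem {z : ℝ} (hz : z ∈ Ico X.l X.r) (n : ℕ) : X.T^[n] z ∈ Ico X.l X.r :=
  X.hmaps.iterate n hz

theorem T_inj {z z' : ℝ} (hz : z ∈ Ico X.l X.r) (hz' : z' ∈ Ico X.l X.r) (h : X.T z = X.T z') :
    z = z' := by
  rw [← X.hinv_left z hz, ← X.hinv_left z' hz', h]

theorem iter_inj {n : ℕ} {z z' : ℝ} (hz : z ∈ Ico X.l X.r) (hz' : z' ∈ Ico X.l X.r)
    (h : X.T^[n] z = X.T^[n] z') : z = z' := by
  induction n generalizing z z' with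
  | zero => exact h
  | succ n ih =>
    rw [Function.iterate_succ_apply, Function.iterate_succ_apply] at h
    exact X.T_inj hz hz' (ih (X.T_mem hz) (X.T_mem hz') h)

/-- the first `n` letters of the natural coding of `z` -/
noncomputable def code (X : IET s) : ℕ → ℝ → List (Fin s)
  | 0, _ => []
  | n + 1, z => X.idx z :: code X n (X.T z)

theorem code_succ (n : ℕ) (z : ℝ) : X.code (n + 1) z = X.idx z :: X.code n (X.T z) := rfl

theorem code_length (n : ℕ) (z : ℝ) : (X.code n z).length = n := by
  induction n generalizing z with
  | zero => rfl
  | succ n ih => simp [code_succ, ih]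

theorem code_add (m n : ℕ) (z : ℝ) :
    X.code (m + n) z = X.code m z ++ X.code n (X.T^[m] z) := by
  induction m generalizing z with
  | zero => simp [code]
  | succ m ih => rw [Nat.add_right_comm m 1 n, code_succ, ih]; rfl

theorem mem_Iw_iff {x : List (Fin s)} {z : ℝ} :
    z ∈ X.Iw x ↔ z ∈ Ico X.l X.r ∧ X.code x.length z = x := by
  induction x generalizing z with
  | nil => simp [Iw, code]
  | cons b x ih =>
    simp only [Iw, mem_inter_iff, mem_preimage, ih, List.length_cons, code_succ, List.cons.injEq]
    constructor
    · rintro ⟨h1, h2, h3⟩; exact ⟨X.I_sub h1, X.idx_eq h1, h3⟩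
    · rintro ⟨h1, h2, h3⟩; exact ⟨h2 ▸ X.idx_mem h1, X.T_mem h1, h3⟩

theorem mem_Iw_append {x y : List (Fin s)} {z : ℝ} :
    z ∈ X.Iw (x ++ y) ↔ z ∈ X.Iw x ∧ X.T^[x.length] z ∈ X.Iw y := by
  simp only [mem_Iw_iff, List.length_append, code_add]
  constructor
  · rintro ⟨h1, h2⟩
    obtain ⟨h3, h4⟩ := List.append_inj h2 (X.code_length _ _)
    exact ⟨⟨h1, h3⟩, X.iter_mem h1 _, h4⟩
  · rintro ⟨⟨h1, h2⟩, _, h3⟩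
    exact ⟨h1, by rw [h2, h3]⟩

theorem code_eq_of_le {m n : ℕ} (h : m ≤ n) {z z' : ℝ} (hc : X.code n z = X.code n z') :
    X.code m z = X.code m z' := by
  obtain ⟨k, rfl⟩ := Nat.exists_eq_add_of_le h
  rw [code_add, code_add] at hc
  exact (List.append_inj hc (by simp [code_length])).1

theorem code_eq_shift {m n N : ℕ} (h : m + n ≤ N) {z z' : ℝ} (hc : X.code N z = X.code N z') :
    X.code n (X.T^[m] z) = X.code n (X.T^[m] z') := by
  have := X.code_eq_of_le h hc
  rw [code_add, code_add] at this
  exact (List.append_inj this (by simp [code_length])).2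

theorem idx_eq_of_code {m n : ℕ} (h : m < n) {z z' : ℝ} (hc : X.code n z = X.code n z') :
    X.idx (X.T^[m] z) = X.idx (X.T^[m] z') := by
  have := X.code_eq_shift (m := m) (n := 1) h hc
  simpa [code] using this

theorem trans_of_code {n : ℕ} {z z' : ℝ} (hz : z ∈ Ico X.l X.r) (hz' : z' ∈ Ico X.l X.r)
    (hc : X.code n z = X.code n z') : ∀ m ≤ n, X.T^[m] z' = X.T^[m] z + (z' - z) := by
  intro m
  induction m with
  | zero => intro _; simp
  | succ m ih =>
    intro hm
    have h1 := X.idx_mem (X.iter_mem hz m)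
    have h2 := X.idx_mem (X.iter_mem hz' m)
    rw [Function.iterate_succ_apply', Function.iterate_succ_apply', X.T_eq h1, X.T_eq h2,
      ← X.idx_eq_of_code hm hc, ih (by omega)]
    ring

theorem code_between {n : ℕ} {z z' y : ℝ} (hz : z ∈ Ico X.l X.r) (hz' : z' ∈ Ico X.l X.r)
    (hc : X.code n z = X.code n z') (h1 : z ≤ y) (h2 : y ≤ z') : X.code n y = X.code n z := by
  induction n generalizing z z' y with
  | zero => rfl
  | succ n ih =>
    simp only [code_succ, List.cons.injEq] at hc ⊢
    have m1 := X.idx_mem hz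
    have m2 := X.idx_mem hz'
    rw [← hc.1] at m2
    have m3 : y ∈ X.I (X.idx z) := ⟨m1.1.trans h1, h2.trans_lt m2.2⟩
    refine ⟨X.idx_eq m3, ih (X.T_mem hz) (X.T_mem hz') hc.2 ?_ ?_⟩
    · rw [X.T_eq m1, X.T_eq m3]; linarith
    · rw [X.T_eq m2, X.T_eq m3]; linarith

theorem code_right {z : ℝ} (hz : z ∈ Ico X.l X.r) (n : ℕ) :
    ∃ ε > 0, ∀ y, z ≤ y → y < z + ε → y ∈ Ico X.l X.r ∧ X.code n y = X.code n z := by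
  induction n generalizing z with
  | zero =>
    exact ⟨X.r - z, by linarith [hz.2], fun y h1 h2 => ⟨⟨hz.1.trans h1, by linarith⟩, rfl⟩⟩
  | succ n ih =>
    obtain ⟨ε, he, h⟩ := ih (X.T_mem hz)
    have m1 := X.idx_mem hz
    refine ⟨min ε (X.γ (X.idx z).succ - z), lt_min he (by linarith [m1.2]), fun y h1 h2 => ?_⟩
    have h3 := min_le_left ε (X.γ (X.idx z).succ - z)
    have h4 := min_le_right ε (X.γ (X.idx z).succ - z)
    have m3 : y ∈ X.I (X.idx z) := ⟨m1.1.trans h1, by linarith⟩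
    have := h (X.T y) (by rw [X.T_eq m1, X.T_eq m3]; linarith)
      (by rw [X.T_eq m1, X.T_eq m3]; linarith)
    exact ⟨X.I_sub m3, by rw [code_succ, code_succ, X.idx_eq m3, this.2]⟩

theorem l_mem : X.l ∈ Ico X.l X.r := ⟨le_refl _, X.hlr⟩

/-- The preimage of the left endpoint is a separation point. -/
theorem exists_sep_of_T_eq_l {z : ℝ} (hz : z ∈ Ico X.l X.r) (h : X.T z = X.l) :
    ∃ k, z = X.sep k := by
  refine ⟨X.idx z, ?_⟩
  have m1 := X.idx_mem hz
  have m2 := X.sep_mem_I (X.idx z)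
  have h3 := (X.T_mem (X.I_sub m2)).1
  rw [X.T_eq m2, ← h, X.T_eq m1] at h3
  exact le_antisymm (by linarith) m1.1

/-- Left endpoint of a cylinder. -/
theorem exists_left {z : ℝ} (hz : z ∈ Ico X.l X.r) (n : ℕ) :
    ∃ u ∈ Ico X.l X.r, X.code n u = X.code n z ∧
      (∀ y ∈ Ico X.l X.r, X.code n y = X.code n z → u ≤ y) ∧
      (u = X.l ∨ ∃ m < n, ∃ i : Fin s, (i : ℕ) ≠ 0 ∧ X.T^[m] u = X.sep i) := by
  induction n generalizing z with
  | zero => exact ⟨X.l, X.l_mem, rfl, fun y hy _ => hy.1, Or.inl rfl⟩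
  | succ n ih =>
    obtain ⟨u, hu, hc, hmin, hend⟩ := ih (X.T_mem hz)
    have m1 := X.idx_mem hz
    have m2 := X.sep_mem_I (X.idx z)
    have hTz := X.T_eq m1
    have huz : u ≤ X.T z := hmin _ (X.T_mem hz) rfl
    have hmin' : ∀ y ∈ Ico X.l X.r, X.code (n + 1) y = X.code (n + 1) z →
        X.sep (X.idx z) ≤ y ∧ u ≤ y + X.α (X.idx z) := by
      intro y hy h
      simp only [code_succ, List.cons.injEq] at h
      have m4 := X.idx_mem hy
      rw [h.1] at m4
      have := hmin _ (X.T_mem hy) h.2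
      rw [X.T_eq m4] at this
      exact ⟨m4.1, this⟩
    by_cases hcase : X.sep (X.idx z) + X.α (X.idx z) < u
    · have m3 : u - X.α (X.idx z) ∈ X.I (X.idx z) := by
        refine ⟨?_, ?_⟩
        · change X.sep _ ≤ _; linarith
        · have := m1.2; linarith
      have hT : X.T (u - X.α (X.idx z)) = u := by rw [X.T_eq m3]; ring
      refine ⟨u - X.α (X.idx z), X.I_sub m3, ?_, ?_, ?_⟩
      · rw [code_succ, code_succ, X.idx_eq m3, hT, hc]
      · intro y hy h
        have := (hmin' y hy h).2
        linarith
      · rcases hend with rfl | ⟨m, hm, i, hi, h⟩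
        · obtain ⟨k, hk⟩ := X.exists_sep_of_T_eq_l (X.I_sub m3) hT
          by_cases hk0 : (k : ℕ) = 0
          · left; rw [hk, X.sep_zero hk0]
          · right; exact ⟨0, by omega, k, hk0, hk⟩
        · right
          refine ⟨m + 1, by omega, i, hi, ?_⟩
          rw [Function.iterate_succ_apply, hT, h]
    · push Not at hcase
      refine ⟨X.sep (X.idx z), X.I_sub m2, ?_, fun y hy h => (hmin' y hy h).1, ?_⟩
      · rw [code_succ, code_succ, X.idx_eq m2]
        congr 1
        rw [← hc]
        apply X.code_between hu (X.T_mem hz) hc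
        · rw [X.T_eq m2]; exact hcase
        · rw [X.T_eq m2, hTz]; linarith [m1.1, show X.sep (X.idx z) = X.γ (X.idx z).castSucc from rfl]
      · by_cases hk0 : (X.idx z : ℕ) = 0
        · left; rw [X.sep_zero hk0]
        · right; exact ⟨0, by omega, _, hk0, rfl⟩

/-- interior points of a cylinder do not meet separation points early -/
theorem ne_sep_of_lt {n : ℕ} {z y : ℝ} (hz : z ∈ Ico X.l X.r) (hy : y ∈ Ico X.l X.r)
    (hc : X.code n z = X.code n y) (hlt : z < y) {m : ℕ} (hm : m < n) (i : Fin s) :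
    X.T^[m] y ≠ X.sep i := by
  intro h
  have h1 := X.trans_of_code hz hy hc m hm.le
  have h2 := X.idx_mem (X.iter_mem hz m)
  rw [X.idx_eq_of_code hm hc, h, X.idx_eq (X.sep_mem_I i)] at h2
  have h3 : X.sep i ≤ X.T^[m] z := h2.1
  linarith

theorem regular_nat (hreg : X.Regular) {i j : Fin s} (hi : (i : ℕ) ≠ 0) (hj : (j : ℕ) ≠ 0)
    {m n : ℕ} (h : X.T^[m] (X.sep i) = X.T^[n] (X.sep j)) : i = j ∧ m = n := by
  have := hreg i j hi hj m n (by simpa [iter] using h)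
  exact ⟨this.1, by exact_mod_cast this.2⟩

end IET

namespace IET

variable {s : ℕ} (X : IET s)

open MeasureTheory in
/-- Poincaré recurrence for interval exchanges. -/
theorem recur_Ico {z ε : ℝ} (he : 0 < ε) (hsub : Ico z (z + ε) ⊆ Ico X.l X.r) :
    ∃ y ∈ Ico z (z + ε), ∃ m ≠ 0, X.T^[m] y ∈ Ico z (z + ε) := by
  classical
  let T' : ℝ → ℝ := fun x => x + ∑ i, (X.I i).indicator (fun _ => X.α i) x
  have hI : ∀ i, MeasurableSet (X.I i) := fun i => measurableSet_Ico
  have hmeas : Measurable T' := by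
    refine measurable_id.add (Finset.measurable_sum _ fun i _ => ?_)
    exact measurable_const.indicator (hI i)
  have hTI : ∀ i, ∀ x ∈ X.I i, T' x = x + X.α i := by
    intro i x hx
    simp only [T']
    congr 1
    rw [Finset.sum_eq_single i]
    · exact indicator_of_mem hx _
    · intro j _ hj
      exact indicator_of_notMem (fun h => hj (X.I_unique h hx)) _
    · simp
  have hT' : ∀ x ∈ Ico X.l X.r, T' x = X.T x := by
    intro x hx
    rw [hTI _ _ (X.idx_mem hx), X.T_eq (X.idx_mem hx)]
  have hIU : (⋃ i, X.I i) = Ico X.l X.r := by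
    ext x
    simp only [mem_iUnion]
    exact ⟨fun ⟨i, hi⟩ => X.I_sub hi, fun h => X.exists_I h⟩
  let J : Fin s → Set ℝ := fun i => (fun y => y + -X.α i) ⁻¹' X.I i
  have hJ : ∀ i, MeasurableSet (J i) := fun i => (measurable_add_const _) (hI i)
  have hJT : ∀ i y, y ∈ J i → X.T (y + -X.α i) = y := by
    intro i y hy
    rw [X.T_eq hy]; ring
  have hJU : (⋃ i, J i) = Ico X.l X.r := by
    ext x
    simp only [mem_iUnion]
    constructor
    · rintro ⟨i, hi⟩
      rw [← hJT i x hi]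
      exact X.T_mem (X.I_sub hi)
    · intro h
      have h1 := X.idx_mem (X.hinvmaps h)
      refine ⟨X.idx (X.Tinv x), ?_⟩
      · change x + -X.α (X.idx (X.Tinv x)) ∈ X.I (X.idx (X.Tinv x))
        have h2 := X.T_eq h1
        rw [X.hinv_right x h] at h2
        have : x + -X.α (X.idx (X.Tinv x)) = X.Tinv x := by linarith
        rw [this]; exact h1
  have hmp : MeasurePreserving T' (volume.restrict (Ico X.l X.r))
      (volume.restrict (Ico X.l X.r)) := by
    refine ⟨hmeas, ?_⟩
    ext A hA
    rw [Measure.map_apply hmeas hA, Measure.restrict_apply (hmeas hA), Measure.restrict_apply hA]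
    conv_lhs => rw [← hIU]
    rw [← hJU, inter_iUnion, inter_iUnion, measure_iUnion, measure_iUnion]
    · congr 1
      funext i
      have : T' ⁻¹' A ∩ X.I i = (fun y => y + X.α i) ⁻¹' (A ∩ J i) := by
        ext x
        simp only [mem_inter_iff, mem_preimage, J, add_neg_cancel_right]
        constructor
        · rintro ⟨h1, h2⟩; rw [hTI i x h2] at h1; exact ⟨h1, h2⟩
        · rintro ⟨h1, h2⟩; rw [hTI i x h2]; exact ⟨h1, h2⟩
      rw [this, measure_preimage_add_right]
    · intro i j hij
      rw [Function.onFun, Set.disjoint_left]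
      rintro x ⟨_, h1⟩ ⟨_, h2⟩
      have := X.T_inj (X.I_sub h1) (X.I_sub h2) ((hJT i x h1).trans (hJT j x h2).symm)
      apply hij
      refine X.I_unique h1 (j := j) ?_
      exact (congrArg (fun q => q ∈ X.I j) this).mpr h2
    · exact fun i => hA.inter (hJ i)
    · intro i j hij
      rw [Function.onFun, Set.disjoint_left]
      rintro x ⟨_, h1⟩ ⟨_, h2⟩
      exact hij (X.I_unique h1 h2)
    · exact fun i => (hmeas hA).inter (hI i)
  obtain ⟨y, hy, m, hm, h⟩ := hmp.exists_mem_iterate_mem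
    (s := Ico z (z + ε)) measurableSet_Ico.nullMeasurableSet (by
      rw [Measure.restrict_apply measurableSet_Ico, inter_eq_left.2 hsub, Real.volume_Ico]
      simpa using he)
  refine ⟨y, hy, m, hm, ?_⟩
  have key : ∀ m, T'^[m] y = X.T^[m] y := by
    intro m
    induction m with
    | zero => rfl
    | succ m ih =>
      rw [Function.iterate_succ_apply', Function.iterate_succ_apply', ih,
        hT' _ (X.iter_mem (hsub hy) m)]
  rwa [key] at h

theorem recur {z : ℝ} (hz : z ∈ Ico X.l X.r) (n : ℕ) :
    ∃ y ∈ Ico X.l X.r, X.code n y = X.code n z ∧ ∃ m ≠ 0, X.code n (X.T^[m] y) = X.code n z := by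
  obtain ⟨ε, he, h⟩ := X.code_right hz n
  obtain ⟨y, hy, m, hm, h'⟩ := X.recur_Ico he (fun y hy => (h y hy.1 hy.2).1)
  exact ⟨y, (h y hy.1 hy.2).1, (h y hy.1 hy.2).2, m, hm, (h _ h'.1 h'.2).2⟩

theorem const_of_locally {Y : Type*} (f : ℝ → Y) {a b : ℝ} (hab : a ≤ b)
    (h : ∀ y ∈ Icc a b, ∃ ε > 0, ∀ y' ∈ Icc a b, |y' - y| < ε → f y' = f y) : f a = f b := by
  let _ : TopologicalSpace Y := ⊥
  have : DiscreteTopology Y := ⟨rfl⟩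
  refine (isPreconnected_Icc (a := a) (b := b)).constant (f := f) ?_
    (left_mem_Icc.2 hab) (right_mem_Icc.2 hab)
  intro y hy
  obtain ⟨ε, he, h⟩ := h y hy
  refine (continuousWithinAt_const (b := f y)).congr_of_eventuallyEq ?_ rfl
  rw [Filter.EventuallyEq, eventually_nhdsWithin_iff, Metric.eventually_nhds_iff]
  exact ⟨ε, he, fun y' hd hy' => h y' hy' (by simpa [Real.dist_eq] using hd)⟩

theorem code_snoc {n : ℕ} {y y' : ℝ} (h : X.code n y' = X.code n y)
    (h' : X.idx (X.T^[n] y') = X.idx (X.T^[n] y)) : X.code (n + 1) y' = X.code (n + 1) y := by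
  rw [code_add, code_add, h]
  simp [code, h']

theorem step (hreg : X.Regular) {G Y : Type*} [Group G] [MulAction G Y] (v : Fin s → G)
    (φ : ℝ → Y) (hφ : ∀ z ∈ Ico X.l X.r, φ z = v (X.idx z) • φ (X.T z)) (n : ℕ)
    (h : ∀ z ∈ Ico X.l X.r, ∀ z' ∈ Ico X.l X.r, X.code (n + 1) z = X.code (n + 1) z' →
      φ z = φ z') :
    ∀ z ∈ Ico X.l X.r, ∀ z' ∈ Ico X.l X.r, X.code n z = X.code n z' → φ z = φ z' := by
  have main : ∀ z ∈ Ico X.l X.r, ∀ z' ∈ Ico X.l X.r, X.code n z = X.code n z' → z ≤ z' →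
      φ z = φ z' := by
    intro z hz z' hz' hc hle
    refine const_of_locally φ hle fun y hy => ?_
    have hmem : ∀ y ∈ Icc z z', y ∈ Ico X.l X.r :=
      fun y hy => ⟨hz.1.trans hy.1, hy.2.trans_lt hz'.2⟩
    have hcode : ∀ y ∈ Icc z z', X.code n y = X.code n z :=
      fun y hy => X.code_between hz hz' hc hy.1 hy.2
    have hyI := hmem y hy
    have hb := X.idx_mem (X.iter_mem hyI n)
    set b := X.idx (X.T^[n] y) with hbdef
    have hb2 := hb.2
    -- points in the cylinder of length `n + 1`
    have hgood : ∀ y' ∈ Icc z z', X.T^[n] y + (y' - y) ∈ X.I b → φ y' = φ y := by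
      intro y' hy' hI
      have hcc : X.code n y = X.code n y' := (hcode y hy).trans (hcode y' hy').symm
      have ht := X.trans_of_code hyI (hmem y' hy') hcc n le_rfl
      refine h _ (hmem y' hy') _ hyI (X.code_snoc hcc.symm ?_)
      rw [ht, X.idx_eq hI]
    rcases lt_or_eq_of_le hb.1 with hlt | heq
    · refine ⟨min (X.T^[n] y - X.γ b.castSucc) (X.γ b.succ - X.T^[n] y),
        lt_min (by linarith) (by linarith), fun y' hy' hd => hgood y' hy' ?_⟩
      rw [lt_min_iff, abs_lt, abs_lt] at hd
      exact ⟨by linarith [hd.1.1], by linarith [hd.2.2]⟩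
    · have heq' : X.T^[n] y = X.sep b := heq.symm
      rcases lt_or_eq_of_le hy.1 with hzy | rfl
      ·
        have hcy : X.code n z = X.code n y := (hcode y hy).symm
        have hb0 : (b : ℕ) ≠ 0 := by
          intro hb0
          rw [X.sep_zero hb0] at heq'
          cases n with
          | zero => simp at heq'; linarith [hz.1]
          | succ m =>
            rw [Function.iterate_succ_apply'] at heq'
            obtain ⟨k, hk⟩ := X.exists_sep_of_T_eq_l (X.iter_mem hyI m) heq'
            exact X.ne_sep_of_lt hz hyI hcy hzy (Nat.lt_succ_self m) k hk
        have hp := X.hinvmaps hyI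
        have hpT := X.hinv_right y hyI
        set p := X.Tinv y with hpdef
        have ha := X.idx_mem hp
        set a := X.idx p with hadef
        have ha2 := ha.2
        have hpa : X.γ a.castSucc < p := by
          refine lt_of_le_of_ne ha.1 fun hpe => ?_
          have hpe' : p = X.sep a := hpe.symm
          have h1 : X.T^[n + 1] (X.sep a) = X.sep b := by
            rw [Function.iterate_succ_apply, ← hpe', hpT, heq']
          by_cases ha0 : (a : ℕ) = 0
          · rw [X.sep_zero ha0] at h1
            have hq := X.hinvmaps X.l_mem
            have hqT := X.hinv_right X.l X.l_mem
            obtain ⟨k, hk⟩ := X.exists_sep_of_T_eq_l hq hqT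
            rw [hk] at hqT
            by_cases hk0 : (k : ℕ) = 0
            · rw [X.sep_zero hk0] at hqT
              have hfix : X.T^[n + 1] X.l = X.l := Function.iterate_fixed hqT _
              rw [hfix] at h1
              have : X.idx (X.sep b) = b := X.idx_eq (X.sep_mem_I b)
              rw [← h1, ← X.sep_zero hk0, X.idx_eq (X.sep_mem_I k)] at this
              exact hb0 (this ▸ hk0)
            · rw [← hqT, ← Function.iterate_succ_apply] at h1
              have := (X.regular_nat hreg (n := 0) hk0 hb0 h1).2
              omega
          · have := (X.regular_nat hreg (n := 0) ha0 hb0 h1).2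
            omega
        refine ⟨min (p - X.γ a.castSucc) (X.γ a.succ - p),
          lt_min (by linarith) (by linarith), fun y' hy' hd => ?_⟩
        rw [lt_min_iff, abs_lt, abs_lt] at hd
        have hq : p + (y' - y) ∈ X.I a := ⟨by linarith [hd.1.1], by linarith [hd.2.2]⟩
        have hqT : X.T (p + (y' - y)) = y' := by
          have h1 := X.T_eq ha
          rw [X.T_eq hq]
          rw [hpT] at h1
          linarith
        have h1 : φ (p + (y' - y)) = φ p := by
          refine h _ (X.I_sub hq) _ hp ?_
          rw [code_succ, code_succ, X.idx_eq hq, hqT, hpT, hcode y hy, hcode y' hy']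
        rw [hφ _ (X.I_sub hq), hφ _ hp, X.idx_eq hq, hqT, hpT] at h1
        exact MulAction.injective _ h1
      · refine ⟨X.γ b.succ - X.T^[n] z, by linarith, fun y' hy' hd => hgood y' hy' ?_⟩
        rw [abs_lt] at hd
        exact ⟨by linarith [hy'.1, hb.1], by linarith [hd.2]⟩
  intro z hz z' hz' hc
  rcases le_total z z' with hle | hle
  · exact main z hz z' hz' hc hle
  · exact (main z' hz' z hz hc.symm hle).symm

theorem const_of_equivariant (hreg : X.Regular) {G Y : Type*} [Group G] [MulAction G Y]
    (v : Fin s → G) (φ : ℝ → Y) (hφ : ∀ z ∈ Ico X.l X.r, φ z = v (X.idx z) • φ (X.T z)) (n : ℕ)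
    (h : ∀ z ∈ Ico X.l X.r, ∀ z' ∈ Ico X.l X.r, X.code n z = X.code n z' → φ z = φ z') :
    ∀ z ∈ Ico X.l X.r, ∀ z' ∈ Ico X.l X.r, φ z = φ z' := by
  induction n with
  | zero => exact fun z hz z' hz' => h z hz z' hz' rfl
  | succ n ih => exact ih (X.step hreg v φ hφ n h)

end IET

namespace IET

variable {s : ℕ} (X : IET s)

/-- `k` is the first return time of `z ∈ I_w` to `I_w`. -/
def FR (w : List (Fin s)) (z : ℝ) (k : ℕ) : Prop :=
  z ∈ X.Iw w ∧ 0 < k ∧ X.T^[k] z ∈ X.Iw w ∧ ∀ j, 0 < j → j < k → X.T^[j] z ∉ X.Iw w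

variable {X} {w : List (Fin s)}

theorem Iw_mem {z : ℝ} (h : z ∈ X.Iw w) : z ∈ Ico X.l X.r := (X.mem_Iw_iff.1 h).1

theorem iter_mem_Iw_congr {z z' : ℝ} {N j : ℕ} (hz' : z' ∈ Ico X.l X.r)
    (hc : X.code N z = X.code N z') (hj : j + w.length ≤ N) (h : X.T^[j] z ∈ X.Iw w) :
    X.T^[j] z' ∈ X.Iw w := by
  rw [mem_Iw_iff] at h ⊢
  exact ⟨X.iter_mem hz' j, by rw [← X.code_eq_shift hj hc, h.2]⟩

theorem FR.congr {z z' : ℝ} {k : ℕ} (h : X.FR w z k) (hz' : z' ∈ Ico X.l X.r)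
    (hc : X.code (k + w.length) z = X.code (k + w.length) z') : X.FR w z' k := by
  obtain ⟨h1, h2, h3, h4⟩ := h
  refine ⟨iter_mem_Iw_congr (j := 0) hz' hc (by omega) h1, h2,
    iter_mem_Iw_congr hz' hc le_rfl h3, fun j hj hjk hn => h4 j hj hjk ?_⟩
  exact iter_mem_Iw_congr (Iw_mem h1) hc.symm (by omega) hn

theorem FR.unique {z : ℝ} {k k' : ℕ} (h : X.FR w z k) (h' : X.FR w z k') : k = k' := by
  rcases lt_trichotomy k k' with hlt | heq | hlt
  · exact absurd h.2.2.1 (h'.2.2.2 k h.2.1 hlt)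
  · exact heq
  · exact absurd h'.2.2.1 (h.2.2.2 k' h'.2.1 hlt)

theorem exists_FR {z : ℝ} (hz : z ∈ X.Iw w) {n : ℕ} (hn : 0 < n) (h : X.T^[n] z ∈ X.Iw w) :
    ∃ k ≤ n, X.FR w z k := by
  classical
  have hex : ∃ n, 0 < n ∧ X.T^[n] z ∈ X.Iw w := ⟨n, hn, h⟩
  refine ⟨Nat.find hex, Nat.find_min' hex ⟨hn, h⟩, hz, (Nat.find_spec hex).1,
    (Nat.find_spec hex).2, fun j hj hjk hm => Nat.find_min hex hjk ⟨hj, hm⟩⟩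

theorem code_return {z : ℝ} {k : ℕ} (h3 : X.T^[k] z ∈ X.Iw w) :
    X.code (k + w.length) z = X.code k z ++ w := by
  rw [code_add, (X.mem_Iw_iff.1 h3).2]

theorem fact_code {z : ℝ} (hz : z ∈ Ico X.l X.r) (n : ℕ) : X.code n z ∈ X.Fact :=
  ⟨z, X.mem_Iw_iff.2 ⟨hz, by rw [code_length]⟩⟩

/-- a return of `z` to `I_w` at time `k` gives an element of `Γ(w)`. -/
theorem gamma_of_return {z : ℝ} {k : ℕ} (hz : z ∈ X.Iw w) (hk : 0 < k)
    (h3 : X.T^[k] z ∈ X.Iw w) :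
    X.code k (X.T^[w.length] z) ∈ Gamma X.Fact w ∧
      w ++ X.code k (X.T^[w.length] z) = X.code k z ++ w := by
  have hzI := Iw_mem hz
  have h1 : w ++ X.code k (X.T^[w.length] z) = X.code (w.length + k) z := by
    rw [code_add, (X.mem_Iw_iff.1 hz).2]
  have h2 : w ++ X.code k (X.T^[w.length] z) = X.code k z ++ w := by
    rw [h1, add_comm, code_return h3]
  refine ⟨⟨fact_code (X.iter_mem hzI _) _, ?_, X.code k z, ?_, h2⟩, h2⟩
  · rw [h1]; exact fact_code hzI _
  · intro h
    have := X.code_length k z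
    rw [h] at this
    simp at this; omega

theorem return_of_gamma {x y : List (Fin s)} {z : ℝ} (hz : z ∈ X.Iw (w ++ x))
    (hxy : w ++ x = y ++ w) : z ∈ X.Iw w ∧ X.T^[x.length] z ∈ X.Iw w ∧
      X.code x.length z = y ∧ x = X.code x.length (X.T^[w.length] z) := by
  have hlen : x.length = y.length := by
    have := congrArg List.length hxy; simp at this; omega
  have h1 := X.mem_Iw_append.1 hz
  rw [hxy] at hz
  have h2 := X.mem_Iw_append.1 hz
  rw [hlen]
  refine ⟨h1.1, h2.2, (X.mem_Iw_iff.1 h2.1).2, ?_⟩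
  rw [← hlen, (X.mem_Iw_iff.1 h1.2).2]

theorem retW_of_FR {z : ℝ} {k : ℕ} (h : X.FR w z k) :
    X.code k (X.T^[w.length] z) ∈ RetW X.Fact w := by
  obtain ⟨h1, h2, h3, h4⟩ := h
  refine ⟨(gamma_of_return h1 h2 h3).1, ?_⟩
  rintro p ⟨_, _, y, hy, hpy⟩ t ht hx
  have hlen := congrArg List.length hx
  rw [code_length, List.length_append] at hlen
  have ht' : 0 < t.length := List.length_pos_iff.2 ht
  have hpl : p.length = y.length := by
    have := congrArg List.length hpy; simp at this; omega
  have hp' : 0 < p.length := by rw [hpl]; exact List.length_pos_iff.2 hy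
  have hz : z ∈ X.Iw (w ++ p) := by
    rw [mem_Iw_append]
    refine ⟨h1, X.mem_Iw_iff.2 ⟨X.iter_mem (Iw_mem h1) _, ?_⟩⟩
    rw [hlen, code_add] at hx
    exact (List.append_inj hx (X.code_length _ _)).1
  exact h4 p.length hp' (by omega) (return_of_gamma hz hpy).2.1

theorem FR_of_retW {x : List (Fin s)} (hx : x ∈ RetW X.Fact w) :
    ∃ z, X.FR w z x.length ∧ x = X.code x.length (X.T^[w.length] z) := by
  obtain ⟨⟨_, ⟨z, hz⟩, y, hy, hxy⟩, hmin⟩ := hx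
  obtain ⟨h1, h2, h3, h4⟩ := return_of_gamma hz hxy
  have hpos : 0 < x.length := by
    have := congrArg List.length hxy
    have h' := List.length_pos_iff.2 hy
    simp at this; omega
  refine ⟨z, ⟨h1, hpos, h2, fun j hj hjk hn => ?_⟩, h4⟩
  refine hmin _ (gamma_of_return h1 hj hn).1 (X.code (x.length - j) (X.T^[j] (X.T^[w.length] z)))
    ?_ ?_
  · intro h
    have := congrArg List.length h
    rw [code_length] at this
    simp at this; omega
  · rw [← code_add, Nat.add_sub_cancel' hjk.le]
    exact h4

/-- There are at most `s` first return words. -/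
theorem retW_card (hreg : X.Regular) (hw : w ∈ X.Fact) :
    (RetW X.Fact w).Finite ∧ (RetW X.Fact w).ncard ≤ s := by
  obtain ⟨z0, hz0⟩ := hw
  obtain ⟨u, hu, huc, humin, -⟩ := X.exists_left (Iw_mem hz0) w.length
  rw [(X.mem_Iw_iff.1 hz0).2] at huc humin
  have key : ∀ x ∈ RetW X.Fact w, ∃ i : Fin s, ∃ z, X.FR w z x.length ∧
      x = X.code x.length (X.T^[w.length] z) ∧
      (((i : ℕ) = 0 ∧ z = u) ∨ ((i : ℕ) ≠ 0 ∧ u < z ∧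
        ∃ m < x.length + w.length, X.T^[m] z = X.sep i)) := by
    intro x hx
    obtain ⟨z, hz, hxz⟩ := FR_of_retW hx
    obtain ⟨z', hz', hc', _, hend⟩ := X.exists_left (Iw_mem hz.1) (x.length + w.length)
    have hFR := hz.congr hz' hc'.symm
    have hx' : x = X.code x.length (X.T^[w.length] z') := by
      rw [X.code_eq_shift (by omega) hc']; exact hxz
    have hle : u ≤ z' := humin z' hz' (X.mem_Iw_iff.1 hFR.1).2
    rcases lt_or_eq_of_le hle with hlt | heq
    · rcases hend with hl | ⟨m, hm, i, hi, h⟩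
      · exact absurd hu.1 (by rw [← hl]; exact not_le.2 hlt)
      · exact ⟨i, z', hFR, hx', Or.inr ⟨hi, hlt, m, hm, h⟩⟩
    · exact ⟨⟨0, Nat.pos_of_ne_zero X.s_ne_zero⟩, z', hFR, hx', Or.inl ⟨rfl, heq.symm⟩⟩
  have : NeZero s := ⟨X.s_ne_zero⟩
  choose! f hf using key
  have aux : ∀ x x' z z' i m m', X.FR w z x → X.FR w z' x' → u < z →
      m < x + w.length → m' < x' + w.length → X.T^[m] z = X.sep i →
      X.T^[m'] z' = X.sep i → m ≤ m' → z = z' := by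
    intro x x' z z' i m m' hz hz' huz hm hm' hs hs' hle
    obtain ⟨p, rfl⟩ := Nat.exists_eq_add_of_le hle
    have hzz : z = X.T^[p] z' := by
      apply X.iter_inj (n := m) (Iw_mem hz.1) (X.iter_mem (Iw_mem hz'.1) p)
      rw [← Function.iterate_add_apply, hs, hs']
    by_cases hp : p = 0
    · subst hp; exact hzz
    · exfalso
      have hpx : x' ≤ p := by
        by_contra hlt
        exact hz'.2.2.2 p (Nat.pos_of_ne_zero hp) (by omega) (hzz ▸ hz.1)
      refine X.ne_sep_of_lt (n := w.length) hu (Iw_mem hz.1) ?_ huz (m := m) (by omega) i hs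
      rw [huc, (X.mem_Iw_iff.1 hz.1).2]
  have hinj : InjOn f (RetW X.Fact w) := by
    intro x hx x' hx' hff
    obtain ⟨z, hz, hxz, hd⟩ := hf x hx
    obtain ⟨z', hz', hxz', hd'⟩ := hf x' hx'
    rw [← hff] at hd'
    have hzz : z = z' := by
      rcases hd with ⟨h0, rfl⟩ | ⟨h0, hlt, m, hm, h⟩ <;>
        rcases hd' with ⟨h0', rfl⟩ | ⟨h0', hlt', m', hm', h'⟩
      · rfl
      · exact absurd h0 h0'
      · exact absurd h0' h0
      · rcases le_total m m' with hle | hle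
        · exact aux _ _ z z' _ m m' hz hz' hlt hm hm' h h' hle
        · exact (aux _ _ z' z _ m' m hz' hz hlt' hm' hm h' h hle).symm
    subst hzz
    have hl := hz.unique hz'
    rw [hxz, hxz', hl]
  have hfin : (RetW X.Fact w).Finite :=
    Set.Finite.of_injOn (mapsTo_univ f _) hinj finite_univ
  refine ⟨hfin, ?_⟩
  have := Set.ncard_le_ncard_of_injOn f (fun a _ => mem_univ (f a)) hinj finite_univ
  simpa [Set.ncard_univ] using this

theorem exists_bound (hreg : X.Regular) (hw : w ∈ X.Fact) :
    ∃ B, ∀ z k, X.FR w z k → k ≤ B := by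
  obtain ⟨B, hB⟩ := ((retW_card hreg hw).1.image List.length).bddAbove
  refine ⟨B, fun z k h => hB ⟨_, retW_of_FR h, X.code_length _ _⟩⟩

theorem exists_return {B : ℕ} (hB : ∀ z k, X.FR w z k → k ≤ B) {z : ℝ} (hz : z ∈ X.Iw w) :
    ∃ k, X.FR w z k := by
  obtain ⟨y, hy, hc, m, hm, h⟩ := X.recur (Iw_mem hz) (B + w.length)
  have h1 : y ∈ X.Iw w := iter_mem_Iw_congr (j := 0) hy hc.symm (by omega) hz
  have h2 : X.T^[m] y ∈ X.Iw w :=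
    iter_mem_Iw_congr (j := 0) (X.iter_mem hy m) h.symm (by omega) hz
  obtain ⟨k, _, hk⟩ := exists_FR h1 (Nat.pos_of_ne_zero hm) h2
  have := hB y k hk
  exact ⟨k, hk.congr (Iw_mem hz) (X.code_eq_of_le (by omega) hc)⟩

theorem exists_hit {B : ℕ} (hB : ∀ z k, X.FR w z k → k ≤ B) {z : ℝ} (hz : z ∈ Ico X.l X.r)
    {n : ℕ} (hn : X.T^[n] z ∈ X.Iw w) : ∃ k ≤ n, k ≤ B ∧ X.T^[k] z ∈ X.Iw w := by
  classical
  have hex : ∃ n, X.T^[n] z ∈ X.Iw w := ⟨n, hn⟩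
  obtain ⟨k, hkn, hk, hmin⟩ : ∃ k ≤ n, X.T^[k] z ∈ X.Iw w ∧ ∀ j < k, X.T^[j] z ∉ X.Iw w :=
    ⟨Nat.find hex, Nat.find_min' hex hn, Nat.find_spec hex, fun j hj => Nat.find_min hex hj⟩
  refine ⟨k, hkn, ?_, hk⟩
  by_contra hkB
  obtain ⟨y, hy, hc, m, hm, h⟩ := X.recur hz (k + w.length)
  have h1 : X.T^[k] y ∈ X.Iw w := iter_mem_Iw_congr hy hc.symm le_rfl hk
  have h2 : ∀ j < k, X.T^[m + j] y ∉ X.Iw w := by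
    intro j hj hmem
    rw [add_comm, Function.iterate_add_apply] at hmem
    exact hmin j hj (iter_mem_Iw_congr hz h (by omega) hmem)
  rcases le_or_gt m k with hmk | hmk
  · exact h2 (k - m) (by omega) (by rw [Nat.add_sub_cancel' hmk]; exact h1)
  · have hspec := Nat.findGreatest_spec (P := fun j => X.T^[j] y ∈ X.Iw w)
      (show k ≤ m - 1 by omega) h1
    have hle := Nat.findGreatest_le (P := fun j => X.T^[j] y ∈ X.Iw w) (m - 1)
    have hgr := fun j => Nat.findGreatest_is_greatest (P := fun j => X.T^[j] y ∈ X.Iw w)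
      (n := m - 1) (k := j)
    set j := Nat.findGreatest (fun j => X.T^[j] y ∈ X.Iw w) (m - 1)
    obtain ⟨k', hk'⟩ := exists_return hB hspec
    have hk'B := hB _ _ hk'
    have hpos := hk'.2.1
    have h3 : X.T^[j + k'] y ∈ X.Iw w := by
      rw [add_comm, Function.iterate_add_apply]; exact hk'.2.2.1
    rcases le_or_gt (j + k') (m - 1) with h4 | h4
    · exact hgr (j + k') (by omega) h4 h3
    · refine h2 (j + k' - m) (by omega) ?_
      rwa [Nat.add_sub_cancel' (by omega)]

/-- the value of a word in the free group -/
def wd (x : List (Fin s)) : FreeGroup (Fin s) := (x.map FreeGroup.of).prod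

theorem wd_append (x y : List (Fin s)) : wd (x ++ y) = wd x * wd y := by
  simp [wd]

theorem wd_cons (a : Fin s) (y : List (Fin s)) : wd (a :: y) = FreeGroup.of a * wd y := by
  simp [wd]

variable (X w) in
/-- the subgroup generated by the left return words -/
def HL : Subgroup (FreeGroup (Fin s)) :=
  Subgroup.closure {g | ∃ z k, X.FR w z k ∧ g = wd (X.code k z)}

theorem return_mem_HL {n : ℕ} : ∀ {z : ℝ}, z ∈ X.Iw w → X.T^[n] z ∈ X.Iw w →
    wd (X.code n z) ∈ X.HL w := by
  induction n using Nat.strong_induction_on with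
  | _ n ih =>
    intro z hz hn
    rcases Nat.eq_zero_or_pos n with rfl | hpos
    · exact one_mem _
    · obtain ⟨k, hkn, hk⟩ := exists_FR hz hpos hn
      have hkp := hk.2.1
      have h1 : wd (X.code k z) ∈ X.HL w := Subgroup.subset_closure ⟨z, k, hk, rfl⟩
      have h2 : wd (X.code (n - k) (X.T^[k] z)) ∈ X.HL w := by
        apply ih (n - k) (by omega) hk.2.2.1
        rw [← Function.iterate_add_apply, Nat.sub_add_cancel hkn]
        exact hn
      have := mul_mem h1 h2
      rwa [← wd_append, ← code_add, Nat.add_sub_cancel' hkn] at this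

variable (X w) in
/-- coset-valued function on the interval -/
def phi (z : ℝ) : Set (FreeGroup (Fin s)) :=
  {g | ∃ n, X.T^[n] z ∈ X.Iw w ∧ (wd (X.code n z))⁻¹ * g ∈ X.HL w}

open Pointwise in
theorem HL_eq_top (hreg : X.Regular) (hw : w ∈ X.Fact) : X.HL w = ⊤ := by
  obtain ⟨B, hB⟩ := exists_bound hreg hw
  obtain ⟨z0, hz0⟩ := hw
  have hequi : ∀ z ∈ Ico X.l X.r, X.phi w z = FreeGroup.of (X.idx z) • X.phi w (X.T z) := by
    intro z hz
    ext g
    rw [Set.mem_smul_set_iff_inv_smul_mem, smul_eq_mul]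
    have hback : ∀ n, X.T^[n + 1] z ∈ X.Iw w → (wd (X.code (n + 1) z))⁻¹ * g ∈ X.HL w →
        (FreeGroup.of (X.idx z))⁻¹ * g ∈ X.phi w (X.T z) := by
      intro n h1 h2
      refine ⟨n, by rwa [Function.iterate_succ_apply] at h1, ?_⟩
      rw [code_succ, wd_cons] at h2
      rwa [← mul_assoc, ← mul_inv_rev]
    constructor
    · rintro ⟨n, hn, hg⟩
      cases n with
      | zero =>
        obtain ⟨k, hk⟩ := exists_return hB (z := z) hn
        have hkp := hk.2.1
        obtain ⟨k, rfl⟩ : ∃ k', k = k' + 1 := ⟨k - 1, by omega⟩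
        refine hback k hk.2.2.1 (mul_mem (inv_mem (return_mem_HL hn hk.2.2.1)) ?_)
        simpa [code, wd] using hg
      | succ n => exact hback n hn hg
    · rintro ⟨n, hn, hg⟩
      refine ⟨n + 1, by rwa [Function.iterate_succ_apply], ?_⟩
      rwa [code_succ, wd_cons, mul_inv_rev, mul_assoc]
  have hfac : ∀ z ∈ Ico X.l X.r, ∀ z' ∈ Ico X.l X.r,
      X.code (B + w.length) z = X.code (B + w.length) z' → X.phi w z ⊆ X.phi w z' := by
    rintro z hz z' hz' hc g ⟨n, hn, hg⟩
    obtain ⟨k, hkn, hkB, hk⟩ := exists_hit hB hz hn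
    have h1 : wd (X.code (n - k) (X.T^[k] z)) ∈ X.HL w := by
      apply return_mem_HL hk
      rw [← Function.iterate_add_apply, Nat.sub_add_cancel hkn]
      exact hn
    refine ⟨k, iter_mem_Iw_congr hz' hc (by omega) hk, ?_⟩
    rw [← X.code_eq_of_le (by omega) hc]
    rw [← Nat.add_sub_cancel' hkn, code_add, wd_append, mul_inv_rev, mul_assoc] at hg
    have := mul_mem h1 hg
    rwa [mul_inv_cancel_left] at this
  have hconst := X.const_of_equivariant hreg (fun a => FreeGroup.of a) (X.phi w) hequi
    (B + w.length) (fun z hz z' hz' hc =>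
      Subset.antisymm (hfac z hz z' hz' hc) (hfac z' hz' z hz hc.symm))
  have hone : (1 : FreeGroup (Fin s)) ∈ X.phi w z0 := ⟨0, hz0, by simp [code, wd]⟩
  have hsub : X.phi w z0 ⊆ X.HL w := by
    rintro g ⟨n, hn, hg⟩
    have := mul_mem (return_mem_HL hz0 hn) hg
    rwa [mul_inv_cancel_left] at this
  rw [← top_le_iff, ← FreeGroup.closure_range_of, Subgroup.closure_le]
  rintro _ ⟨a, rfl⟩
  have ha := X.I_sub (X.sep_mem_I a)
  have h1 := hequi _ ha
  rw [X.idx_eq (X.sep_mem_I a), hconst _ ha _ (Iw_mem hz0),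
    hconst _ (X.T_mem ha) _ (Iw_mem hz0)] at h1
  apply hsub
  rw [h1, Set.mem_smul_set_iff_inv_smul_mem, smul_eq_mul, inv_mul_cancel]
  exact hone

theorem retW_generates (hreg : X.Regular) (hw : w ∈ X.Fact) :
    Subgroup.closure ((fun x : List (Fin s) => (x.map FreeGroup.of).prod) '' RetW X.Fact w)
      = ⊤ := by
  set K := Subgroup.closure
    ((fun x : List (Fin s) => (x.map FreeGroup.of).prod) '' RetW X.Fact w) with hK
  have hle : X.HL w ≤ K.comap (MulAut.conj (wd w)⁻¹).toMonoidHom := by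
    unfold HL
    rw [Subgroup.closure_le]
    rintro _ ⟨z, k, hk, rfl⟩
    have h1 := congrArg wd (gamma_of_return hk.1 hk.2.1 hk.2.2.1).2
    rw [wd_append, wd_append] at h1
    have h2 : wd (X.code k (X.T^[w.length] z)) ∈ K :=
      Subgroup.subset_closure ⟨_, retW_of_FR hk, rfl⟩
    change (wd w)⁻¹ * wd (X.code k z) * (wd w)⁻¹⁻¹ ∈ K
    rw [inv_inv, mul_assoc, ← h1, inv_mul_cancel_left]
    exact h2
  rw [HL_eq_top hreg hw] at hle
  rw [eq_top_iff]
  intro g _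
  have : (wd w)⁻¹ * (wd w * g * (wd w)⁻¹) * (wd w)⁻¹⁻¹ ∈ K :=
    hle (Subgroup.mem_top (wd w * g * (wd w)⁻¹))
  simpa [mul_assoc] using this

end IET

/-- for a regular interval exchange transformation on the
alphabet `A = Fin s` and `w ∈ F(T)`, the set of first right return words to
`w` is a basis of the free group on `A` (the image of the letters under some
automorphism); in particular it has exactly `Card A = s` elements. -/
theorem iet_return_words_basis {s : ℕ} (X : IET s) (hreg : X.Regular)
    (w : List (Fin s)) (hw : w ∈ X.Fact) :
    (∃ θ : FreeGroup (Fin s) ≃* FreeGroup (Fin s),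
      (fun x : List (Fin s) => (x.map FreeGroup.of).prod) '' IET.RetW X.Fact w =
        Set.range fun a : Fin s => θ (FreeGroup.of a)) ∧
    (IET.RetW X.Fact w).ncard = s := by
  have : NeZero s := ⟨X.s_ne_zero⟩
  obtain ⟨h1, h2⟩ := IET.retW_card hreg hw
  exact basis_of_generating _ h1 h2 (IET.retW_generates hreg hw)
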